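/- There exist universal constants C, c > 0 such that for every integer d ≥ 0 and every ε ∈ (0,1), there is a sample size m ≤ C·(d+1)·(log((d+1)/ε))^c / ε² and a learning algorithm A using m samples over [−1,1) such that: for every ε/(64(d+1))-well-behaved probability distribution p over [−1,1), with probability at least 9/10 over m i.i.d. samples s drawn from p, A(s) is a probability density over [−1,1) given by a single polynomial of degree at most d and satisfies d_TV(p, A(s)) ≤ 3·opt_{1,d}(p)·(1+ε) + C·ε. (Theorem thm:agno-kis1.) -/

import Mathlib

open MeasureTheory Set
open scoped ENNReal

noncomputable def tvDist (p q : Measure ℝ) : ℝ :=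
  ⨆ A : {S : Set ℝ // MeasurableSet S}, |(p A.1).toReal - (q A.1).toReal|

def IsPiecewisePoly (a b : ℝ) (t d : ℕ) (f : ℝ → ℝ) : Prop :=
  ∃ x : Fin (t + 1) → ℝ, x 0 = a ∧ x (Fin.last t) = b ∧ Monotone x ∧
    ∀ i : Fin t, ∃ P : Polynomial ℝ, P.natDegree ≤ d ∧
      ∀ y ∈ Set.Ico (x i.castSucc) (x i.succ), f y = P.eval y

def IsPiecewisePolyDist (q : Measure ℝ) (a b : ℝ) (t d : ℕ) : Prop :=
  IsProbabilityMeasure q ∧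
  ∃ f : ℝ → ℝ, (∀ y ∈ Set.Ico a b, 0 ≤ f y) ∧
    q = (volume.restrict (Set.Ico a b)).withDensity (fun y => ENNReal.ofReal (f y)) ∧
    IsPiecewisePoly a b t d f

noncomputable def optTD (p : Measure ℝ) (t d : ℕ) : ℝ :=
  sInf {x : ℝ | ∃ q : Measure ℝ, IsPiecewisePolyDist q (-1) 1 t d ∧ x = tvDist p q}

noncomputable def samples (p : Measure ℝ) (m : ℕ) : Measure (Fin m → ℝ) :=
  Measure.pi fun _ => p

section
open Metric Module

theorem card_le_of_separated_of_norm_le_one {E : Type*} [NormedAddCommGroup E] [NormedSpace ℝ E]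
    [FiniteDimensional ℝ E] {δ : ℝ} (hδ : 0 < δ) (s : Finset E) (hs : ∀ c ∈ s, ‖c‖ ≤ 1)
    (h : ∀ c ∈ s, ∀ d ∈ s, c ≠ d → δ ≤ ‖c - d‖) :
    (s.card : ℝ) ≤ (1 + 2 / δ) ^ finrank ℝ E := by
  borelize E
  let μ : Measure E := Measure.addHaar
  have hδ2 : 0 < δ / 2 := by positivity
  have hρ : 0 < 1 + δ / 2 := by positivity
  have D : Set.Pairwise (s : Set E) (Function.onFun Disjoint fun c => ball (c : E) (δ / 2)) := by
    intro c hc d hd hcd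
    apply ball_disjoint_ball
    rw [dist_eq_norm]
    linarith [h c hc d hd hcd]
  have hsub : (⋃ c ∈ s, ball (c : E) (δ / 2)) ⊆ ball (0 : E) (1 + δ / 2) := by
    refine iUnion₂_subset fun x hx => ball_subset_ball' ?_
    rw [dist_zero_right]
    linarith [hs x hx]
  have I : (s.card : ℝ≥0∞) * ENNReal.ofReal ((δ / 2) ^ finrank ℝ E) * μ (ball 0 1) ≤
      ENNReal.ofReal ((1 + δ / 2) ^ finrank ℝ E) * μ (ball 0 1) :=
    calc
      _ = μ (⋃ c ∈ s, ball (c : E) (δ / 2)) := by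
        rw [measure_biUnion_finset D fun c _ => measurableSet_ball]
        simp only [μ.addHaar_ball_of_pos _ hδ2, Finset.sum_const, nsmul_eq_mul, mul_assoc]
      _ ≤ μ (ball (0 : E) (1 + δ / 2)) := measure_mono hsub
      _ = _ := by simp only [μ.addHaar_ball_of_pos _ hρ]
  have J := (ENNReal.mul_le_mul_iff_left (measure_ball_pos _ _ zero_lt_one).ne'
    measure_ball_lt_top.ne).1 I
  have K := ENNReal.toReal_le_of_le_ofReal (pow_nonneg hρ.le _) J
  rw [ENNReal.toReal_mul, ENNReal.toReal_natCast, ENNReal.toReal_ofReal (by positivity)] at K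
  rw [show 1 + 2 / δ = (1 + δ / 2) / (δ / 2) by field_simp; ring, div_pow,
    le_div_iff₀ (by positivity)]
  exact K

theorem exists_net_of_norm_le_one {E : Type*} [NormedAddCommGroup E] [NormedSpace ℝ E]
    [FiniteDimensional ℝ E] {δ : ℝ} (hδ : 0 < δ) (K : Set E) (hK : ∀ x ∈ K, ‖x‖ ≤ 1) :
    ∃ s : Finset E, ↑s ⊆ K ∧ (s.card : ℝ) ≤ (1 + 2 / δ) ^ finrank ℝ E ∧
      ∀ x ∈ K, ∃ y ∈ s, ‖x - y‖ ≤ δ := by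
  classical
  let T : Set (Finset E) :=
    {s | ↑s ⊆ K ∧ ∀ c ∈ s, ∀ d ∈ s, c ≠ d → δ ≤ ‖c - d‖}
  have hT : ∀ s ∈ T, (s.card : ℝ) ≤ (1 + 2 / δ) ^ finrank ℝ E := fun s hs =>
    card_le_of_separated_of_norm_le_one hδ s (fun c hc => hK c (hs.1 hc)) hs.2
  have hne : (Finset.card '' T).Nonempty := ⟨_, ∅, by simp [T], rfl⟩
  have hbdd : BddAbove (Finset.card '' T) := by
    refine ⟨⌊(1 + 2 / δ) ^ finrank ℝ E⌋₊, ?_⟩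
    rintro _ ⟨s, hs, rfl⟩
    exact Nat.le_floor (hT s hs)
  obtain ⟨s, hs, hcard⟩ := Nat.sSup_mem hne hbdd
  refine ⟨s, hs.1, hT s hs, fun x hx => ?_⟩
  by_contra! hfar
  have hxs : x ∉ s := fun hmem => by
    have := hfar x hmem
    simp at this
    linarith
  have hins : insert x s ∈ T := by
    refine ⟨?_, ?_⟩
    · rw [Finset.coe_insert]
      exact Set.insert_subset hx hs.1
    · intro c hc d hd hcd
      rcases Finset.mem_insert.1 hc with rfl | hcs <;> rcases Finset.mem_insert.1 hd with rfl | hds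
      · exact absurd rfl hcd
      · exact (hfar d hds).le
      · rw [norm_sub_rev]
        exact (hfar c hcs).le
      · exact hs.2 c hcs d hds hcd
  have := le_csSup hbdd ⟨_, hins, rfl⟩
  rw [← hcard, Finset.card_insert_of_notMem hxs] at this
  omega

end

/-- `P` is a probability density of degree at most `d` on `[-1, 1)`. -/
structure IsPolyDensity (d : ℕ) (P : Polynomial ℝ) : Prop where
  natDegree_le : P.natDegree ≤ d
  nonneg : ∀ y ∈ Ico (-1 : ℝ) 1, 0 ≤ P.eval y
  integral_eq_one : ∫ x in Ico (-1 : ℝ) 1, P.eval x = 1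

theorem integrable_polynomial_eval (P : Polynomial ℝ) :
    Integrable (fun x => P.eval x) (volume.restrict (Ico (-1 : ℝ) 1)) :=
  (P.continuous.continuousOn.integrableOn_compact isCompact_Icc).mono_set Ico_subset_Icc_self

theorem exists_net_polyDensity (d : ℕ) {δ : ℝ} (hδ : 0 < δ) :
    ∃ (n : ℕ) (Q : Fin n → Polynomial ℝ), (n : ℝ) ≤ (1 + 2 / δ) ^ (d + 1) ∧
      (∀ i, IsPolyDensity d (Q i)) ∧ ∀ P, IsPolyDensity d P →
        ∃ i, ∫ x in Ico (-1 : ℝ) 1, |P.eval x - (Q i).eval x| ≤ δ := by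
  classical
  let L : Polynomial.degreeLT ℝ (d + 1) →ₗ[ℝ] (ℝ →₁[volume.restrict (Ico (-1 : ℝ) 1)] ℝ) :=
    { toFun := fun P => (integrable_polynomial_eval P.1).toL1 _
      map_add' := fun P Q => by
        rw [← Integrable.toL1_add _ _ (integrable_polynomial_eval P.1) (integrable_polynomial_eval Q.1)]
        congr 1
        ext x
        simp
      map_smul' := fun a P => by
        rw [RingHom.id_apply, ← Integrable.toL1_smul _ (integrable_polynomial_eval P.1)]
        congr 1
        ext x
        simp }
  have hnorm : ∀ P, ‖L P‖ = ∫ x in Ico (-1 : ℝ) 1, |P.1.eval x| := fun P => by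
    rw [L1.norm_eq_integral_norm]
    refine integral_congr_ae ?_
    filter_upwards [(integrable_polynomial_eval P.1).coeFn_toL1] with x hx
    rw [← Real.norm_eq_abs, ← hx]
    rfl
  have hfr : Module.finrank ℝ (LinearMap.range L) ≤ d + 1 := by
    refine (LinearMap.finrank_range_le L).trans ?_
    rw [(Polynomial.degreeLTEquiv ℝ (d + 1)).finrank_eq]
    simp
  have hmem : ∀ P, IsPolyDensity d P → P ∈ Polynomial.degreeLT ℝ (d + 1) := fun P hP => by
    rw [Polynomial.degreeLT_succ_eq_degreeLE, Polynomial.mem_degreeLE]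
    exact Polynomial.natDegree_le_iff_degree_le.1 hP.natDegree_le
  let K : Set (LinearMap.range L) := {e | ∃ P, IsPolyDensity d P.1 ∧ L P = e}
  have hK : ∀ x ∈ K, ‖x‖ ≤ 1 := by
    rintro ⟨x, hx⟩ ⟨P, hP, rfl⟩
    change ‖L P‖ ≤ 1
    rw [hnorm]
    exact ((setIntegral_congr_fun measurableSet_Ico
      fun y hy => abs_of_nonneg (hP.nonneg y hy)).trans hP.integral_eq_one).le
  obtain ⟨s, hsK, hscard, hsnet⟩ := exists_net_of_norm_le_one hδ K hK
  choose! R hR using fun (e : LinearMap.range L) (he : e ∈ K) => he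
  let Q : Fin s.card → Polynomial ℝ := fun i => (R (s.equivFin.symm i).1).1
  refine ⟨s.card, Q, hscard.trans (pow_le_pow_right₀ ?_ hfr),
    fun i => (hR _ (hsK (s.equivFin.symm i).2)).1, ?_⟩
  · have : 0 < 2 / δ := by positivity
    linarith
  · intro P hP
    obtain ⟨y, hy, hyδ⟩ := hsnet ⟨L ⟨P, hmem P hP⟩, _, rfl⟩ ⟨⟨P, hmem P hP⟩, hP, rfl⟩
    refine ⟨s.equivFin ⟨y, hy⟩, ?_⟩
    have h1 : ‖L ⟨P, hmem P hP⟩ - (y : _)‖ ≤ δ := hyδ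
    rw [← (hR y (hsK hy)).2, ← map_sub, hnorm] at h1
    simpa [Q] using h1

/-- The measure on `[-1, 1)` with density `P`. -/
noncomputable def polyMeasure (P : Polynomial ℝ) : Measure ℝ :=
  (volume.restrict (Ico (-1 : ℝ) 1)).withDensity fun y => ENNReal.ofReal (P.eval y)

theorem IsPolyDensity.ae_nonneg {d : ℕ} {P : Polynomial ℝ} (hP : IsPolyDensity d P) :
    0 ≤ᵐ[volume.restrict (Ico (-1 : ℝ) 1)] fun x => P.eval x :=
  (ae_restrict_iff' measurableSet_Ico).2 (ae_of_all _ hP.nonneg)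

theorem IsPolyDensity.polyMeasure_real {d : ℕ} {P : Polynomial ℝ} (hP : IsPolyDensity d P)
    {B : Set ℝ} (hB : MeasurableSet B) :
    (polyMeasure P).real B = ∫ x in Ico (-1 : ℝ) 1, B.indicator (fun x => P.eval x) x := by
  rw [integral_indicator hB, integral_eq_lintegral_of_nonneg_ae (ae_restrict_of_ae hP.ae_nonneg)
    P.continuous.aestronglyMeasurable, Measure.real, polyMeasure, withDensity_apply _ hB]

theorem IsPolyDensity.isProbabilityMeasure {d : ℕ} {P : Polynomial ℝ} (hP : IsPolyDensity d P) :
    IsProbabilityMeasure (polyMeasure P) := by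
  constructor
  rw [polyMeasure, withDensity_apply _ MeasurableSet.univ, setLIntegral_univ,
    ← ofReal_integral_eq_lintegral_ofReal (integrable_polynomial_eval P) hP.ae_nonneg,
    hP.integral_eq_one, ENNReal.ofReal_one]

theorem IsPolyDensity.isPiecewisePolyDist {d : ℕ} {P : Polynomial ℝ} (hP : IsPolyDensity d P) :
    IsPiecewisePolyDist (polyMeasure P) (-1) 1 1 d := by
  refine ⟨hP.isProbabilityMeasure, fun y => P.eval y, hP.nonneg, rfl, ![-1, 1], rfl, rfl, ?_,
    fun i => ⟨P, hP.natDegree_le, fun _ _ => rfl⟩⟩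
  rw [Fin.monotone_iff_le_succ]
  intro i
  fin_cases i
  simp

theorem IsPiecewisePolyDist.exists_isPolyDensity {d : ℕ} {q : Measure ℝ}
    (hq : IsPiecewisePolyDist q (-1) 1 1 d) : ∃ P, IsPolyDensity d P ∧ q = polyMeasure P := by
  obtain ⟨hprob, f, hf, rfl, x, hx0, hx1, -, hx⟩ := hq
  obtain ⟨P, hPd, hP⟩ := hx 0
  have hP' : ∀ y ∈ Ico (-1 : ℝ) 1, f y = P.eval y := fun y hy => by
    refine hP y ?_
    change y ∈ Ico (x 0) (x (Fin.last 1))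
    rwa [hx0, hx1]
  have hnn : ∀ y ∈ Ico (-1 : ℝ) 1, 0 ≤ P.eval y := fun y hy => hP' y hy ▸ hf y hy
  have heq : (volume.restrict (Ico (-1 : ℝ) 1)).withDensity (fun y => ENNReal.ofReal (f y)) =
      polyMeasure P :=
    withDensity_congr_ae ((ae_restrict_iff' measurableSet_Ico).2
      (ae_of_all _ fun y hy => by simp only [hP' y hy]))
  refine ⟨P, ⟨hPd, hnn, ?_⟩, heq⟩
  rw [heq] at hprob
  have huniv := hprob.measure_univ
  rw [polyMeasure, withDensity_apply _ MeasurableSet.univ, setLIntegral_univ] at huniv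
  rw [integral_eq_lintegral_of_nonneg_ae
    ((ae_restrict_iff' measurableSet_Ico).2 (ae_of_all _ hnn))
    P.continuous.aestronglyMeasurable, huniv, ENNReal.toReal_one]

theorem isPolyDensity_uniform (d : ℕ) : IsPolyDensity d (Polynomial.C (1 / 2)) where
  natDegree_le := by simp
  nonneg y _ := by simp
  integral_eq_one := by simp; norm_num

theorem IsPolyDensity.eq_uniform {P : Polynomial ℝ} (hP : IsPolyDensity 0 P) :
    P = Polynomial.C (1 / 2) := by
  obtain ⟨a, rfl⟩ := Polynomial.natDegree_eq_zero.1 (Nat.le_zero.1 hP.natDegree_le)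
  have h := hP.integral_eq_one
  simp at h
  congr 1
  linarith

theorem abs_polyMeasure_real_sub_le {d : ℕ} {P Q : Polynomial ℝ} (hP : IsPolyDensity d P)
    (hQ : IsPolyDensity d Q) {B : Set ℝ} (hB : MeasurableSet B) :
    |(polyMeasure P).real B - (polyMeasure Q).real B| ≤
      ∫ x in Ico (-1 : ℝ) 1, |P.eval x - Q.eval x| := by
  have hPi := integrable_polynomial_eval P
  have hQi := integrable_polynomial_eval Q
  rw [hP.polyMeasure_real hB, hQ.polyMeasure_real hB,
    ← integral_sub (hPi.indicator hB) (hQi.indicator hB)]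
  refine abs_integral_le_integral_abs.trans
    (integral_mono ((hPi.indicator hB).sub (hQi.indicator hB)).abs (hPi.sub hQi).abs fun x => ?_)
  by_cases hx : x ∈ B <;> simp [hx]

/-- The set where the density `P` exceeds the density `Q`. -/
def scheffeSet (P Q : Polynomial ℝ) : Set ℝ := {x | Q.eval x < P.eval x}

theorem measurableSet_scheffeSet (P Q : Polynomial ℝ) : MeasurableSet (scheffeSet P Q) :=
  measurableSet_lt Q.continuous.measurable P.continuous.measurable

theorem polyMeasure_real_sub_le_scheffeSet {d : ℕ} {P Q : Polynomial ℝ} (hP : IsPolyDensity d P)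
    (hQ : IsPolyDensity d Q) {B : Set ℝ} (hB : MeasurableSet B) :
    (polyMeasure P).real B - (polyMeasure Q).real B ≤
      (polyMeasure P).real (scheffeSet P Q) - (polyMeasure Q).real (scheffeSet P Q) := by
  have hPi := integrable_polynomial_eval P
  have hQi := integrable_polynomial_eval Q
  have hS := measurableSet_scheffeSet P Q
  rw [hP.polyMeasure_real hB, hQ.polyMeasure_real hB, hP.polyMeasure_real hS,
    hQ.polyMeasure_real hS, ← integral_sub (hPi.indicator hB) (hQi.indicator hB),
    ← integral_sub (hPi.indicator hS) (hQi.indicator hS)]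
  refine integral_mono ((hPi.indicator hB).sub (hQi.indicator hB))
    ((hPi.indicator hS).sub (hQi.indicator hS)) fun x => ?_
  by_cases hx : x ∈ B <;> by_cases hx' : Q.eval x < P.eval x <;>
    simp [hx, hx', scheffeSet] <;> linarith

theorem abs_real_sub_le_tvDist (p q : Measure ℝ) [IsProbabilityMeasure p]
    [IsProbabilityMeasure q] {B : Set ℝ} (hB : MeasurableSet B) :
    |p.real B - q.real B| ≤ tvDist p q := by
  refine le_ciSup (f := fun A : {S : Set ℝ // MeasurableSet S} =>
    |(p A.1).toReal - (q A.1).toReal|) ⟨1, ?_⟩ ⟨B, hB⟩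
  rintro _ ⟨A, rfl⟩
  change |p.real A.1 - q.real A.1| ≤ 1
  have h1 : p.real A.1 ≤ 1 := measureReal_le_one
  have h2 : q.real A.1 ≤ 1 := measureReal_le_one
  have h3 : 0 ≤ p.real A.1 := measureReal_nonneg
  have h4 : 0 ≤ q.real A.1 := measureReal_nonneg
  rw [abs_le]
  constructor <;> linarith

theorem tvDist_le {p q : Measure ℝ} {r : ℝ}
    (h : ∀ B, MeasurableSet B → |p.real B - q.real B| ≤ r) : tvDist p q ≤ r :=
  haveI : Nonempty {S : Set ℝ // MeasurableSet S} := ⟨⟨∅, MeasurableSet.empty⟩⟩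
  ciSup_le fun A => h A.1 A.2

theorem tvDist_nonneg (p q : Measure ℝ) : 0 ≤ tvDist p q :=
  Real.iSup_nonneg fun _ => abs_nonneg _

theorem optTD_nonneg (p : Measure ℝ) (t d : ℕ) : 0 ≤ optTD p t d := by
  refine Real.sInf_nonneg ?_
  rintro _ ⟨q, -, rfl⟩
  exact tvDist_nonneg p q

theorem le_optTD_one {p : Measure ℝ} {d : ℕ} {r : ℝ}
    (h : ∀ P, IsPolyDensity d P → r ≤ tvDist p (polyMeasure P)) : r ≤ optTD p 1 d := by
  refine le_csInf ⟨_, _, (isPolyDensity_uniform d).isPiecewisePolyDist, rfl⟩ ?_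
  rintro _ ⟨q, hq, rfl⟩
  obtain ⟨P, hP, rfl⟩ := hq.exists_isPolyDensity
  exact h P hP

/-- The worst discrepancy, over the sets comparing two candidates, between the prescribed masses
`e` and the masses given by the `i`-th candidate. -/
noncomputable def yatracosScore {n : ℕ} (Q : Fin n → Polynomial ℝ) (e : Fin n × Fin n → ℝ)
    (i : Fin n) : ℝ :=
  ⨆ k : Fin n × Fin n, |e k - (polyMeasure (Q i)).real (scheffeSet (Q k.1) (Q k.2))|

theorem tvDist_le_of_yatracosScore_le {d n : ℕ} {Q : Fin n → Polynomial ℝ} {δ : ℝ}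
    (hQ : ∀ i, IsPolyDensity d (Q i))
    (hnet : ∀ P, IsPolyDensity d P → ∃ i, ∫ x in Ico (-1 : ℝ) 1, |P.eval x - (Q i).eval x| ≤ δ)
    (p : Measure ℝ) [IsProbabilityMeasure p] {e : Fin n × Fin n → ℝ}
    (he : ∀ k, |e k - p.real (scheffeSet (Q k.1) (Q k.2))| ≤ δ) {i : Fin n}
    (hi : ∀ j, yatracosScore Q e i ≤ yatracosScore Q e j) {P : Polynomial ℝ}
    (hP : IsPolyDensity d P) :
    tvDist p (polyMeasure (Q i)) ≤ 3 * tvDist p (polyMeasure P) + 5 * δ := by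
  have : IsProbabilityMeasure (polyMeasure P) := hP.isProbabilityMeasure
  obtain ⟨j, hj⟩ := hnet P hP
  set τ := tvDist p (polyMeasure P)
  have hj' : ∀ B, MeasurableSet B →
      |(polyMeasure P).real B - (polyMeasure (Q j)).real B| ≤ δ := fun B hB =>
    (abs_polyMeasure_real_sub_le hP (hQ j) hB).trans hj
  have hτ : ∀ B, MeasurableSet B → |p.real B - (polyMeasure P).real B| ≤ τ := fun B hB =>
    abs_real_sub_le_tvDist p _ hB
  have hscore : yatracosScore Q e j ≤ 2 * δ + τ := by
    have : Nonempty (Fin n × Fin n) := ⟨(i, i)⟩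
    refine ciSup_le fun k => ?_
    have hS := measurableSet_scheffeSet (Q k.1) (Q k.2)
    have h1 := abs_le.1 (he k)
    have h2 := abs_le.1 (hτ _ hS)
    have h3 := abs_le.1 (hj' _ hS)
    rw [abs_le]
    constructor <;> linarith
  have hle : ∀ l k, |e k - (polyMeasure (Q l)).real (scheffeSet (Q k.1) (Q k.2))| ≤
      yatracosScore Q e l := fun l k =>
    le_ciSup (f := fun k : Fin n × Fin n =>
      |e k - (polyMeasure (Q l)).real (scheffeSet (Q k.1) (Q k.2))|) (Finite.bddAbove_range _) k
  have hij := hi j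
  refine tvDist_le fun B hB => ?_
  have h1 := abs_le.1 (hτ B hB)
  have h2 := abs_le.1 (hj' B hB)
  have h3 := polyMeasure_real_sub_le_scheffeSet (hQ i) (hQ j) hB
  have h4 := polyMeasure_real_sub_le_scheffeSet (hQ j) (hQ i) hB
  have h5 := abs_le.1 (hle i (i, j))
  have h6 := abs_le.1 (hle j (i, j))
  have h7 := abs_le.1 (hle i (j, i))
  have h8 := abs_le.1 (hle j (j, i))
  rw [abs_le]
  constructor <;> linarith

theorem samples_real_sum_ge_le (p : Measure ℝ) [IsProbabilityMeasure p] {f : ℝ → ℝ}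
    (hf : Measurable f) {a : ℝ} (hfa : ∀ x, f x ∈ Icc a (a + 1)) (m : ℕ) {δ : ℝ} (hδ : 0 ≤ δ) :
    (samples p m).real {s | m * δ ≤ ∑ k, (f (s k) - ∫ x, f x ∂p)} ≤
      Real.exp (-(2 * m * δ ^ 2)) := by
  rcases Nat.eq_zero_or_pos m with rfl | hm
  · simp [samples]
  have hm' : (0 : ℝ) < m := by exact_mod_cast hm
  have : IsProbabilityMeasure (samples p m) := by unfold samples; infer_instance
  have hsub : ∀ k ∈ (Finset.univ : Finset (Fin m)),
      ProbabilityTheory.HasSubgaussianMGF (fun s : Fin m → ℝ => f (s k) - ∫ x, f x ∂p)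
        ((‖(a + 1) - a‖₊ / 2) ^ 2) (samples p m) := fun k _ => by
    have h := ProbabilityTheory.hasSubgaussianMGF_of_mem_Icc (μ := samples p m)
      (X := fun s : Fin m → ℝ => f (s k)) (a := a) (b := a + 1)
      (hf.comp (measurable_pi_apply k)).aemeasurable (ae_of_all _ fun s => hfa (s k))
    have hint : ∫ s, f (s k) ∂(samples p m) = ∫ x, f x ∂p :=
      integral_comp_eval (μ := fun _ : Fin m => p) hf.aestronglyMeasurable
    rwa [hint] at h
  have hindep : ProbabilityTheory.iIndepFun
      (fun k (s : Fin m → ℝ) => f (s k) - ∫ x, f x ∂p) (samples p m) :=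
    ProbabilityTheory.iIndepFun_pi (μ := fun _ : Fin m => p)
      (X := fun _ x => f x - ∫ x, f x ∂p) fun _ => (hf.sub_const _).aemeasurable
  refine (ProbabilityTheory.HasSubgaussianMGF.measure_sum_ge_le_of_iIndepFun hindep hsub
    (by positivity)).trans (le_of_eq ?_)
  congr 1
  simp
  field_simp

/-- The empirical mass of `B`, as a function of the membership pattern of the sample. -/
noncomputable def empiricalMass {m : ℕ} (b : Fin m → Prop) : ℝ :=
  open Classical in (∑ k, if b k then (1 : ℝ) else 0) / m

theorem samples_real_empiricalMass_le (p : Measure ℝ) [IsProbabilityMeasure p] {B : Set ℝ}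
    (hB : MeasurableSet B) {m : ℕ} (hm : 0 < m) {δ : ℝ} (hδ : 0 ≤ δ) :
    (samples p m).real {s | δ < |empiricalMass (fun k => s k ∈ B) - p.real B|} ≤
      2 * Real.exp (-(2 * m * δ ^ 2)) := by
  classical
  have hm' : (0 : ℝ) < m := by exact_mod_cast hm
  have hmeas : Measurable (B.indicator (1 : ℝ → ℝ)) := measurable_one.indicator hB
  have : IsProbabilityMeasure (samples p m) := by unfold samples; infer_instance
  have hupper := samples_real_sum_ge_le p hmeas (a := 0)
    (fun x => by by_cases hx : x ∈ B <;> simp [hx]) m hδ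
  have hlower := samples_real_sum_ge_le p hmeas.neg (a := -1)
    (fun x => by by_cases hx : x ∈ B <;> simp [hx]) m hδ
  refine (measureReal_mono ?_).trans ((measureReal_union_le _ _).trans
    ((add_le_add hupper hlower).trans_eq (two_mul _).symm))
  intro s hs
  have hsum : ∑ k, B.indicator (1 : ℝ → ℝ) (s k) =
      m * empiricalMass fun k => s k ∈ B := by
    rw [empiricalMass, mul_div_cancel₀ _ hm'.ne']
    exact Finset.sum_congr rfl fun k _ => by simp [indicator_apply]
  have hint : ∫ x, B.indicator (1 : ℝ → ℝ) x ∂p = p.real B := integral_indicator_one hB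
  simp only [Pi.neg_apply, integral_neg, Finset.sum_sub_distrib, Finset.sum_neg_distrib, hsum,
    hint, Finset.sum_const, Finset.card_univ, Fintype.card_fin, nsmul_eq_mul, mem_union,
    mem_ofPred_eq] at hs ⊢
  rcases lt_abs.1 hs with h | h
  · left
    nlinarith
  · right
    nlinarith

/-- The learner: candidates from a finite net are compared with the empirical measure. -/
theorem exists_learner {d n m : ℕ} (hm : 0 < m) (hn : 0 < n) {Q : Fin n → Polynomial ℝ} {δ : ℝ}
    (hδ : 0 ≤ δ) (hQ : ∀ i, IsPolyDensity d (Q i))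
    (hnet : ∀ P, IsPolyDensity d P → ∃ i, ∫ x in Ico (-1 : ℝ) 1, |P.eval x - (Q i).eval x| ≤ δ)
    (hsize : (n : ℝ) ^ 2 * (2 * Real.exp (-(2 * m * δ ^ 2))) ≤ 1 / 10) :
    ∃ A : (Fin m → ℝ) → Measure ℝ, Measurable A ∧ ∀ p : Measure ℝ, IsProbabilityMeasure p →
      (9 / 10 : ℝ≥0∞) ≤ samples p m {s | IsPiecewisePolyDist (A s) (-1) 1 1 d ∧
        tvDist p (A s) ≤ 3 * optTD p 1 d + 5 * δ} := by
  have : Nonempty (Fin n) := ⟨⟨0, hn⟩⟩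
  have hmin : ∀ b : Fin n × Fin n → Fin m → Prop, ∃ i, ∀ j,
      yatracosScore Q (fun k => empiricalMass (b k)) i ≤
        yatracosScore Q (fun k => empiricalMass (b k)) j := fun b => Finite.exists_min _
  choose sel hsel using hmin
  let pattern : (Fin m → ℝ) → Fin n × Fin n → Fin m → Prop :=
    fun s k l => s l ∈ scheffeSet (Q k.1) (Q k.2)
  have hpattern : Measurable pattern :=
    measurable_pi_lambda _ fun k => measurable_pi_lambda _ fun l =>
      (measurableSet_scheffeSet (Q k.1) (Q k.2)).mem.comp (measurable_pi_apply l)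
  refine ⟨fun s => polyMeasure (Q (sel (pattern s))),
    (Measurable.of_discrete (f := fun b => polyMeasure (Q (sel b)))).comp hpattern, fun p hp => ?_⟩
  have : IsProbabilityMeasure (samples p m) := by unfold samples; infer_instance
  let bad : Fin n × Fin n → Set (Fin m → ℝ) := fun k =>
    {s | δ < |empiricalMass (pattern s k) - p.real (scheffeSet (Q k.1) (Q k.2))|}
  have hbad_meas : ∀ k, MeasurableSet (bad k) := fun k =>
    measurableSet_lt measurable_const
      (((Measurable.of_discrete (f := fun b : Fin n × Fin n → Fin m → Prop =>
        empiricalMass (b k))).comp hpattern).sub_const _).abs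
  have hbad : (samples p m).real (⋃ k, bad k) ≤ 1 / 10 := by
    refine (measureReal_iUnion_fintype_le _).trans ((Finset.sum_le_sum fun k _ =>
      samples_real_empiricalMass_le p (measurableSet_scheffeSet (Q k.1) (Q k.2)) hm hδ).trans
      (le_trans (le_of_eq ?_) hsize))
    simp
    ring
  have hgood : (9 / 10 : ℝ≥0∞) ≤ samples p m (⋃ k, bad k)ᶜ := by
    have h := probReal_compl_eq_one_sub (μ := samples p m) (MeasurableSet.iUnion hbad_meas)
    have h9 : (9 / 10 : ℝ) ≤ (samples p m).real (⋃ k, bad k)ᶜ := by rw [h]; linarith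
    rw [← ofReal_measureReal]
    refine le_trans (le_of_eq ?_) (ENNReal.ofReal_le_ofReal h9)
    rw [ENNReal.ofReal_div_of_pos (by norm_num)]
    simp
  refine hgood.trans (measure_mono fun s hs => ⟨(hQ _).isPiecewisePolyDist, ?_⟩)
  have he : ∀ k, |empiricalMass (pattern s k) - p.real (scheffeSet (Q k.1) (Q k.2))| ≤ δ :=
    fun k => not_lt.1 fun hk => hs (mem_iUnion.2 ⟨k, hk⟩)
  have hopt : (tvDist p (polyMeasure (Q (sel (pattern s)))) - 5 * δ) / 3 ≤ optTD p 1 d :=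
    le_optTD_one fun P hP => by
      have := tvDist_le_of_yatracosScore_le hQ hnet p he (hsel (pattern s)) hP
      linarith
  change tvDist p (polyMeasure (Q (sel (pattern s)))) ≤ _
  linarith

/-- A sample size that is large enough for the net and small enough for the final bound. -/
theorem exists_sampleSize {d n : ℕ} (hd : 1 ≤ d) {ε : ℝ} (hε : 0 < ε) (hε1 : ε < 1)
    (hn : (n : ℝ) ≤ (1 + 2 / ε) ^ (d + 1)) :
    ∃ m : ℕ, 0 < m ∧ (n : ℝ) ^ 2 * (2 * Real.exp (-(2 * m * ε ^ 2))) ≤ 1 / 10 ∧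
      (m : ℝ) ≤ 10 * ((d : ℝ) + 1) * Real.log (((d : ℝ) + 1) / ε) / ε ^ 2 := by
  have hd' : (1 : ℝ) ≤ d := by exact_mod_cast hd
  have hexp3 : (20 : ℝ) ≤ Real.exp 3 := by
    have h1 := Real.exp_one_gt_d9
    have h2 : Real.exp 3 = Real.exp 1 ^ 3 := by rw [← Real.exp_nat_mul]; norm_num
    rw [h2]
    calc (20 : ℝ) ≤ 2.7182818283 ^ 3 := by norm_num
      _ ≤ _ := by gcongr
  set ℓ := Real.log (((d : ℝ) + 1) / ε)
  have hℓ : Real.log 2 + Real.log (1 / ε) ≤ ℓ := by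
    rw [← Real.log_mul (by norm_num) (by positivity)]
    refine Real.log_le_log (by positivity) ?_
    rw [mul_one_div]
    gcongr
    linarith
  have hlog2 := Real.log_two_gt_d9
  have hlogε : 0 ≤ Real.log (1 / ε) := Real.log_nonneg (by rw [le_div_iff₀ hε]; linarith)
  have hlog3 : Real.log (3 / ε) ≤ 2 * ℓ := by
    have h3 : Real.log (3 / ε) ≤ Real.log (4 * (1 / ε)) := by
      refine Real.log_le_log (by positivity) ?_
      rw [mul_one_div]
      gcongr
      norm_num
    have h4 : Real.log 4 = 2 * Real.log 2 := by
      rw [show (4 : ℝ) = 2 ^ 2 by norm_num, Real.log_pow]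
      norm_num
    rw [Real.log_mul (by norm_num) (by positivity), h4] at h3
    linarith
  have hlog3_nonneg : 0 ≤ Real.log (3 / ε) :=
    Real.log_nonneg (by rw [le_div_iff₀ hε]; linarith)
  set x := (3 / 2 + ((d : ℝ) + 1) * Real.log (3 / ε)) / ε ^ 2 with hx
  have hx0 : 0 < x := by positivity
  refine ⟨⌈x⌉₊, Nat.ceil_pos.2 hx0, ?_, ?_⟩
  · have hceil : x ≤ (⌈x⌉₊ : ℝ) := Nat.le_ceil x
    have hn3 : (n : ℝ) ^ 2 ≤ Real.exp (2 * ((d + 1) * Real.log (3 / ε))) := by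
      have h1 : (n : ℝ) ≤ (3 / ε) ^ (d + 1) := by
        refine hn.trans (pow_le_pow_left₀ (by positivity) ?_ _)
        rw [le_div_iff₀ hε, add_mul, div_mul_cancel₀ _ hε.ne']
        linarith
      have h2 : Real.exp (2 * ((d + 1) * Real.log (3 / ε))) = ((3 / ε) ^ (d + 1)) ^ 2 := by
        rw [two_mul, Real.exp_add, ← sq]
        congr 1
        have := Real.exp_nat_mul (Real.log (3 / ε)) (d + 1)
        rw [Real.exp_log (by positivity)] at this
        rw [← this]
        push_cast
        rfl
      rw [h2]
      gcongr
    have hxε : x * ε ^ 2 = 3 / 2 + ((d : ℝ) + 1) * Real.log (3 / ε) := by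
      rw [hx, div_mul_cancel₀ _ (by positivity)]
    have hmono : Real.exp (-(2 * (⌈x⌉₊ : ℝ) * ε ^ 2)) ≤
        Real.exp (-(3 + 2 * ((d + 1) * Real.log (3 / ε)))) := by
      refine Real.exp_le_exp.2 (neg_le_neg ?_)
      have := mul_le_mul_of_nonneg_right hceil (sq_nonneg ε)
      linarith
    calc (n : ℝ) ^ 2 * (2 * Real.exp (-(2 * (⌈x⌉₊ : ℝ) * ε ^ 2)))
        ≤ Real.exp (2 * ((d + 1) * Real.log (3 / ε))) *
          (2 * Real.exp (-(3 + 2 * ((d + 1) * Real.log (3 / ε))))) := by gcongr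
      _ = 2 * Real.exp (-3) := by
        rw [mul_left_comm, ← Real.exp_add]
        congr 2
        ring
      _ ≤ 1 / 10 := by
        rw [Real.exp_neg, ← div_eq_mul_inv, div_le_div_iff₀ (Real.exp_pos _) (by norm_num)]
        linarith
  · refine (Nat.ceil_lt_add_one hx0.le).le.trans ?_
    rw [hx, div_add_one (by positivity)]
    refine div_le_div_of_nonneg_right ?_ (by positivity)
    have hε2 : ε ^ 2 ≤ 1 := by nlinarith
    have h1 : ((d : ℝ) + 1) * Real.log (3 / ε) ≤ ((d : ℝ) + 1) * (2 * ℓ) := by gcongr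
    have h2 : (5 / 2 : ℝ) ≤ 4 * (((d : ℝ) + 1) * ℓ) := by nlinarith
    have h3 : 0 ≤ ((d : ℝ) + 1) * ℓ := by linarith
    nlinarith

/-- Theorem thm:agno-kis1: semi-agnostically learning a single degree-d polynomial
density from a well-behaved distribution over [-1,1). -/
theorem learn_single_polynomial_density :
    ∃ C c : ℝ, 0 < C ∧ 0 < c ∧
      ∀ d : ℕ, ∀ ε : ℝ, 0 < ε → ε < 1 →
        ∃ (m : ℕ) (A : (Fin m → ℝ) → Measure ℝ),
          (m : ℝ) ≤ C * ((d : ℝ) + 1) * (Real.log (((d : ℝ) + 1) / ε)) ^ c / ε ^ 2 ∧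
          Measurable A ∧
          ∀ p : Measure ℝ, IsProbabilityMeasure p → p (Set.Ico (-1 : ℝ) 1) = 1 →
            (∀ x : ℝ, p {x} ≤ ENNReal.ofReal (ε / (64 * ((d : ℝ) + 1)))) →
            (9 / 10 : ℝ≥0∞) ≤ samples p m
              {s | IsPiecewisePolyDist (A s) (-1) 1 1 d ∧
                   tvDist p (A s) ≤ 3 * optTD p 1 d * (1 + ε) + C * ε} := by
  refine ⟨10, 1, by norm_num, by norm_num, fun d ε hε hε1 => ?_⟩
  simp only [Real.rpow_one]
  rcases Nat.eq_zero_or_pos d with rfl | hd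
  · refine ⟨0, fun _ => polyMeasure (Polynomial.C (1 / 2)), ?_, measurable_const,
      fun p hp _ _ => ?_⟩
    · have : 0 ≤ Real.log (((0 : ℕ) + 1) / ε) :=
        Real.log_nonneg (by rw [le_div_iff₀ hε]; simpa using hε1.le)
      rw [Nat.cast_zero] at this ⊢
      positivity
    · have hopt : tvDist p (polyMeasure (Polynomial.C (1 / 2))) ≤ optTD p 1 0 :=
        le_optTD_one fun P hP => by rw [hP.eq_uniform]
      have hnn := optTD_nonneg p 1 0
      have hle : tvDist p (polyMeasure (Polynomial.C (1 / 2))) ≤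
          3 * optTD p 1 0 * (1 + ε) + 10 * ε := by nlinarith [mul_nonneg hnn hε.le]
      have huniv : {s : Fin 0 → ℝ | IsPiecewisePolyDist (polyMeasure (Polynomial.C (1 / 2)))
          (-1) 1 1 0 ∧ tvDist p (polyMeasure (Polynomial.C (1 / 2))) ≤
            3 * optTD p 1 0 * (1 + ε) + 10 * ε} = univ :=
        eq_univ_of_forall fun _ => ⟨(isPolyDensity_uniform 0).isPiecewisePolyDist, hle⟩
      have : IsProbabilityMeasure (samples p 0) := by unfold samples; infer_instance
      rw [huniv, measure_univ]
      refine ENNReal.div_le_of_le_mul ?_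
      norm_num
  · obtain ⟨n, Q, hn, hQ, hnet⟩ := exists_net_polyDensity d hε
    obtain ⟨m, hm, hsize, hmle⟩ := exists_sampleSize hd hε hε1 hn
    obtain ⟨i, -⟩ := hnet _ (isPolyDensity_uniform d)
    obtain ⟨A, hA, hlearn⟩ := exists_learner hm i.pos hε.le hQ hnet hsize
    refine ⟨m, A, hmle, hA, fun p hp _ _ => (hlearn p hp).trans (measure_mono fun s hs =>
      ⟨hs.1, hs.2.trans ?_⟩)⟩
    nlinarith [mul_nonneg (optTD_nonneg p 1 d) hε.le]
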